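/- arXiv:1805.05529 — 2 statements merged into one kernel-verified Lean document; each statement's English description precedes it below -/
import Mathlib

section
/- Let N be a positive integer and let ω_1, …, ω_N > 0. Let X be a random N×N real matrix whose rows are independent, with row l distributed according to the beta type II density π^{-N/2} (Γ((ω_l+N)/2)/Γ(ω_l/2)) (1+|x|²)^{-(N+ω_l)/2} on ℝ^N. Then the law of |det X|² equals the law of ∏_{l=1}^N Y_l, where Y_1, …, Y_N are independent and Y_l has the beta prime distribution BetaP[(N−l+1)/2, ω_l/2]. -/
open MeasureTheory Real

/-- The distribution on `ℝ^N` of a row with beta type II density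
`π^{-N/2} (Γ((ω+N)/2)/Γ(ω/2)) (1+|x|²)^{-(N+ω)/2}` on `ℝ^N`. -/
noncomputable def betaIIRowMeasure (N : ℕ) (ω : ℝ) : Measure (Fin N → ℝ) :=
  volume.withDensity fun x =>
    ENNReal.ofReal (π ^ (-(N : ℝ) / 2) * (Real.Gamma ((ω + N) / 2) / Real.Gamma (ω / 2)) *
      (1 + ∑ j, x j ^ 2) ^ (-((N : ℝ) + ω) / 2))

/-- The beta prime distribution `BetaP[a,b]`: the measure on `(0,∞)` with density
`y^{a-1}(1+y)^{-(a+b)} Γ(a+b)/(Γ(a)Γ(b))` with respect to Lebesgue measure. -/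
noncomputable def betaPrimeMeas (a b : ℝ) : Measure ℝ :=
  volume.withDensity fun y =>
    ENNReal.ofReal (if 0 < y then
      y ^ (a - 1) * (1 + y) ^ (-(a + b)) * Real.Gamma (a + b) / (Real.Gamma a * Real.Gamma b)
    else 0)

open scoped ENNReal

theorem MeasureTheory.lintegral_fun_norm_addHaar {E : Type*} [NormedAddCommGroup E]
    [NormedSpace ℝ E] [FiniteDimensional ℝ E] [MeasurableSpace E] [BorelSpace E] [Nontrivial E]
    (μ : Measure E) [μ.IsAddHaarMeasure] {f : ℝ → ℝ≥0∞} (hf : Measurable f) :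
    ∫⁻ x, f ‖x‖ ∂μ = Module.finrank ℝ E * μ (Metric.ball 0 1) *
      ∫⁻ y in Set.Ioi (0 : ℝ), ENNReal.ofReal (y ^ (Module.finrank ℝ E - 1)) * f y := by
  calc
    ∫⁻ x, f ‖x‖ ∂μ = ∫⁻ x : ({(0)}ᶜ : Set E), f ‖x.1‖ ∂(μ.comap (↑)) := by
      rw [lintegral_subtype_comap (measurableSet_singleton _).compl fun x ↦ f ‖x‖,
        restrict_compl_singleton]
    _ = ∫⁻ x, f x.2 ∂μ.toSphere.prod (.volumeIoiPow (Module.finrank ℝ E - 1)) := by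
      simpa using μ.measurePreserving_homeomorphUnitSphereProd.lintegral_comp_emb
        (Homeomorph.measurableEmbedding _) (f ∘ Subtype.val ∘ Prod.snd)
    _ = μ.toSphere Set.univ *
        ∫⁻ x : Set.Ioi (0 : ℝ), f x ∂.volumeIoiPow (Module.finrank ℝ E - 1) := by
      rw [lintegral_prod _ (by fun_prop)]
      simp only [lintegral_const, mul_comm]
    _ = _ := by
      rw [μ.toSphere_apply_univ, Measure.volumeIoiPow,
        lintegral_withDensity_eq_lintegral_mul _ (by fun_prop) (by fun_prop)]
      congr 1
      exact lintegral_subtype_comap measurableSet_Ioi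
        fun a ↦ ENNReal.ofReal (a ^ (Module.finrank ℝ E - 1)) * f a

theorem lintegral_Ioi_comp_sq (g : ℝ → ℝ≥0∞) :
    ∫⁻ y in Set.Ioi (0 : ℝ), g y = ∫⁻ r in Set.Ioi (0 : ℝ), ENNReal.ofReal (2 * r) * g (r ^ 2) := by
  have himage : (fun r : ℝ => r ^ 2) '' Set.Ioi 0 = Set.Ioi 0 := by
    ext y
    constructor
    · rintro ⟨r, hr, rfl⟩
      exact pow_pos (Set.mem_Ioi.1 hr) 2
    · intro hy
      exact ⟨√y, Real.sqrt_pos.2 hy, Real.sq_sqrt (le_of_lt hy)⟩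
  have hinj : Set.InjOn (fun r : ℝ => r ^ 2) (Set.Ioi 0) := fun a ha b hb hab =>
    (pow_left_inj₀ (le_of_lt ha) (le_of_lt hb) two_ne_zero).1 hab
  have h := lintegral_image_eq_lintegral_abs_deriv_mul (f' := fun r => 2 * r) measurableSet_Ioi
    (fun r _ => by simpa using (hasDerivAt_pow 2 r).hasDerivWithinAt) hinj g
  rw [himage] at h
  rw [h]
  refine setLIntegral_congr_fun measurableSet_Ioi fun r hr => ?_
  simp only [abs_of_pos (mul_pos two_pos (Set.mem_Ioi.1 hr))]

theorem lintegral_Ioi_rpow_mul_exp_neg_mul {c a : ℝ} (hc : 0 < c) (ha : 0 < a) :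
    ∫⁻ s in Set.Ioi (0 : ℝ), ENNReal.ofReal (s ^ (c - 1) * Real.exp (-(a * s))) =
      ENNReal.ofReal (Real.Gamma c * a ^ (-c)) := by
  have h := Real.integral_rpow_mul_exp_neg_mul_Ioi hc ha
  rw [one_div, Real.inv_rpow ha.le, ← Real.rpow_neg ha.le, mul_comm] at h
  rw [← h, ofReal_integral_eq_lintegral_ofReal]
  · refine Integrable.of_integral_ne_zero ?_
    rw [h]
    have := Real.Gamma_pos_of_pos hc
    positivity
  · filter_upwards [ae_restrict_mem measurableSet_Ioi] with s hs
    have := Set.mem_Ioi.1 hs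
    simp only [Pi.zero_apply]
    positivity

theorem lintegral_exp_neg_mul_sq {s : ℝ} (hs : 0 < s) :
    ∫⁻ t : ℝ, ENNReal.ofReal (Real.exp (-s * t ^ 2)) = ENNReal.ofReal √(π / s) := by
  rw [← integral_gaussian, ofReal_integral_eq_lintegral_ofReal (integrable_exp_neg_mul_sq hs)
    (.of_forall fun _ => (Real.exp_pos _).le)]

theorem lintegral_add_sq_rpow_neg {a c : ℝ} (ha : 0 < a) (hc : 0 < c) :
    ENNReal.ofReal (Real.Gamma (c + 1 / 2)) *
        ∫⁻ t : ℝ, ENNReal.ofReal ((a + t ^ 2) ^ (-(c + 1 / 2))) =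
      ENNReal.ofReal (√π * Real.Gamma c * a ^ (-c)) := by
  have hc' : 0 < c + 1 / 2 := by positivity
  calc
    _ = ∫⁻ t : ℝ, ∫⁻ s in Set.Ioi (0 : ℝ),
          ENNReal.ofReal (s ^ (c + 1 / 2 - 1) * Real.exp (-((a + t ^ 2) * s))) := by
      rw [← lintegral_const_mul _ (by fun_prop)]
      refine lintegral_congr fun t => ?_
      rw [lintegral_Ioi_rpow_mul_exp_neg_mul hc' (by positivity),
        ENNReal.ofReal_mul (Real.Gamma_pos_of_pos hc').le]
    _ = ∫⁻ s in Set.Ioi (0 : ℝ), ∫⁻ t : ℝ,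
          ENNReal.ofReal (s ^ (c + 1 / 2 - 1) * Real.exp (-((a + t ^ 2) * s))) :=
      lintegral_lintegral_swap (by fun_prop)
    _ = ∫⁻ s in Set.Ioi (0 : ℝ),
          ENNReal.ofReal √π * ENNReal.ofReal (s ^ (c - 1) * Real.exp (-(a * s))) := by
      refine setLIntegral_congr_fun measurableSet_Ioi fun s hs => ?_
      have hs : 0 < s := hs
      have hsplit (t : ℝ) :
          ENNReal.ofReal (s ^ (c + 1 / 2 - 1) * Real.exp (-((a + t ^ 2) * s))) =
            ENNReal.ofReal (s ^ (c + 1 / 2 - 1) * Real.exp (-(a * s))) *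
              ENNReal.ofReal (Real.exp (-s * t ^ 2)) := by
        rw [← ENNReal.ofReal_mul (by positivity), mul_assoc, ← Real.exp_add]
        ring_nf
      simp only [hsplit]
      rw [lintegral_const_mul _ (by fun_prop), lintegral_exp_neg_mul_sq hs,
        ← ENNReal.ofReal_mul (by positivity), ← ENNReal.ofReal_mul (by positivity)]
      congr 1
      have hpow : s ^ (c + 1 / 2 - 1) = s ^ (c - 1) * √s := by
        rw [Real.sqrt_eq_rpow, ← Real.rpow_add hs]
        ring_nf
      rw [hpow, Real.sqrt_div Real.pi_pos.le]
      field_simp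
    _ = _ := by
      rw [lintegral_const_mul _ (by fun_prop), lintegral_Ioi_rpow_mul_exp_neg_mul hc ha,
        ← ENNReal.ofReal_mul (by positivity), mul_assoc]

instance (N : ℕ) (ω : ℝ) : SigmaFinite (betaIIRowMeasure N ω) :=
  SigmaFinite.withDensity_ofReal _

instance (a b : ℝ) : SigmaFinite (betaPrimeMeas a b) :=
  SigmaFinite.withDensity_ofReal _

theorem lintegral_betaIIRowMeasure (N : ℕ) (ω : ℝ) {f : (Fin N → ℝ) → ℝ≥0∞} (hf : Measurable f) :
    ∫⁻ x, f x ∂betaIIRowMeasure N ω =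
      ∫⁻ x, ENNReal.ofReal (π ^ (-(N : ℝ) / 2) *
        (Real.Gamma ((ω + N) / 2) / Real.Gamma (ω / 2)) *
          (1 + ∑ j, x j ^ 2) ^ (-((N : ℝ) + ω) / 2)) * f x :=
  lintegral_withDensity_eq_lintegral_mul _ (by fun_prop) hf

theorem lintegral_betaPrimeMeas (a b : ℝ) {f : ℝ → ℝ≥0∞} (hf : Measurable f) :
    ∫⁻ y, f y ∂betaPrimeMeas a b =
      ∫⁻ y in Set.Ioi 0, ENNReal.ofReal (y ^ (a - 1) * (1 + y) ^ (-(a + b)) * Real.Gamma (a + b) /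
        (Real.Gamma a * Real.Gamma b)) * f y := by
  rw [betaPrimeMeas, lintegral_withDensity_eq_lintegral_mul _ (by
    refine (Measurable.ite measurableSet_Ioi ?_ ?_).ennreal_ofReal <;> fun_prop) hf,
    ← lintegral_indicator measurableSet_Ioi]
  refine lintegral_congr fun y => ?_
  by_cases hy : 0 < y <;> simp [hy]

/-- The squared Euclidean norm of a beta type II vector is beta prime distributed. -/
theorem map_sum_sq_betaIIRowMeasure (n : ℕ) (ω : ℝ) :
    (betaIIRowMeasure (n + 1) ω).map (fun x => ∑ j, x j ^ 2) =
      betaPrimeMeas (((n + 1 : ℕ) : ℝ) / 2) (ω / 2) := by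
  refine Measure.ext_of_lintegral _ fun f hf => ?_
  rw [lintegral_map hf (by fun_prop), lintegral_betaIIRowMeasure _ _ (by fun_prop),
    lintegral_betaPrimeMeas _ _ hf, lintegral_Ioi_comp_sq,
    ← (PiLp.volume_preserving_ofLp (Fin (n + 1))).lintegral_comp (by fun_prop)]
  set K : ℝ := π ^ (-((n + 1 : ℕ) : ℝ) / 2) *
    (Real.Gamma ((ω + (n + 1 : ℕ)) / 2) / Real.Gamma (ω / 2)) with hK
  have hnorm (x : EuclideanSpace ℝ (Fin (n + 1))) : ∑ j, x.ofLp j ^ 2 = ‖x‖ ^ 2 := by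
    simp [EuclideanSpace.norm_sq_eq]
  simp only [hnorm]
  rw [lintegral_fun_norm_addHaar volume (f := fun r => ENNReal.ofReal
      (K * (1 + r ^ 2) ^ (-(((n + 1 : ℕ) : ℝ) + ω) / 2)) * f (r ^ 2)) (by fun_prop),
    finrank_euclideanSpace_fin, EuclideanSpace.volume_ball, Fintype.card_fin,
    ← lintegral_const_mul _ (by fun_prop)]
  refine setLIntegral_congr_fun measurableSet_Ioi fun r hr => ?_
  have hr : 0 < r := hr
  have hΓ : 0 < Real.Gamma (((n + 1 : ℕ) : ℝ) / 2) := Real.Gamma_pos_of_pos (by positivity)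
  simp only [ENNReal.ofReal_one, one_pow, one_mul, ← mul_assoc, Nat.add_sub_cancel]
  rw [← ENNReal.ofReal_natCast, Real.Gamma_add_one (by positivity),
    ← ENNReal.ofReal_mul (by positivity), ← ENNReal.ofReal_mul (by positivity),
    ← ENNReal.ofReal_mul (by positivity), ← ENNReal.ofReal_mul (by positivity)]
  congr 2
  have hpi : √π ^ (n + 1) * π ^ (-((n + 1 : ℕ) : ℝ) / 2) = 1 := by
    rw [Real.sqrt_eq_rpow, ← Real.rpow_mul_natCast Real.pi_pos.le, ← Real.rpow_add Real.pi_pos]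
    ring_nf
    simp
  have hrpow : r * (r ^ 2) ^ (((n + 1 : ℕ) : ℝ) / 2 - 1) = r ^ n := by
    rw [← Real.rpow_natCast r 2, ← Real.rpow_mul hr.le, ← Real.rpow_natCast r n]
    nth_rewrite 1 [← Real.rpow_one r]
    rw [← Real.rpow_add hr]
    push_cast
    ring_nf
  have he₁ : -(((n + 1 : ℕ) : ℝ) / 2 + ω / 2) = -(((n + 1 : ℕ) : ℝ) + ω) / 2 := by ring
  have he₂ : ((n + 1 : ℕ) : ℝ) / 2 + ω / 2 = (ω + (n + 1 : ℕ)) / 2 := by ring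
  rw [he₁, he₂, hK, ← hrpow]
  have hn : ((n + 1 : ℕ) : ℝ) ≠ 0 := by positivity
  generalize ((n + 1 : ℕ) : ℝ) = m at *
  calc
    _ = (√π ^ (n + 1) * π ^ (-m / 2)) * (m / (m / 2)) * (r * (r ^ 2) ^ (m / 2 - 1)) *
        (1 + r ^ 2) ^ (-(m + ω) / 2) * Real.Gamma ((ω + m) / 2) /
          (Real.Gamma (m / 2) * Real.Gamma (ω / 2)) := by ring
    _ = _ := by
      rw [hpi, div_div_cancel₀ hn]
      ring

/-- Deleting a coordinate of a beta type II vector gives a beta type II vector. -/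
theorem measurePreserving_tail_betaIIRowMeasure (n : ℕ) {ω : ℝ} (hω : 0 < ω) :
    MeasurePreserving (fun (x : Fin (n + 1) → ℝ) (j : Fin n) => x j.succ)
      (betaIIRowMeasure (n + 1) ω) (betaIIRowMeasure n ω) := by
  refine ⟨by fun_prop, Measure.ext_of_lintegral _ fun f hf => ?_⟩
  rw [lintegral_map hf (by fun_prop), lintegral_betaIIRowMeasure _ _ (by fun_prop),
    lintegral_betaIIRowMeasure _ _ hf,
    ← (volume_preserving_piFinSuccAbove (fun _ => ℝ) (0 : Fin (n + 1))).symm.lintegral_comp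
      (by fun_prop), Measure.volume_eq_prod, lintegral_prod_symm' _ (by fun_prop)]
  refine lintegral_congr fun x => ?_
  simp only [MeasurableEquiv.piFinSuccAbove_symm_apply, Fin.sum_univ_succ, Fin.insertNthEquiv_apply,
    Fin.insertNth_zero', Fin.cons_zero, Fin.cons_succ]
  rw [lintegral_mul_const _ (by fun_prop)]
  congr 1
  have ha : 0 < 1 + ∑ j, x j ^ 2 := by positivity
  have hc : 0 < ((n : ℝ) + ω) / 2 := by positivity
  have h := lintegral_add_sq_rpow_neg ha hc
  have hexp : -(((n : ℝ) + ω) / 2 + 1 / 2) = -(((n + 1 : ℕ) : ℝ) + ω) / 2 := by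
    push_cast
    ring
  have hΓexp : (ω + (n + 1 : ℕ)) / 2 = ((n : ℝ) + ω) / 2 + 1 / 2 := by
    push_cast
    ring
  have hpi : π ^ (-((n + 1 : ℕ) : ℝ) / 2) * √π = π ^ (-(n : ℝ) / 2) := by
    rw [Real.sqrt_eq_rpow, ← Real.rpow_add Real.pi_pos]
    push_cast
    ring_nf
  have hΓ : 0 < Real.Gamma (ω / 2) := Real.Gamma_pos_of_pos (by positivity)
  have hΓ' : 0 < Real.Gamma (((n : ℝ) + ω) / 2 + 1 / 2) := Real.Gamma_pos_of_pos (by positivity)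
  rw [hexp] at h
  calc
    _ = ∫⁻ t : ℝ, ENNReal.ofReal (π ^ (-((n + 1 : ℕ) : ℝ) / 2) / Real.Gamma (ω / 2)) *
          (ENNReal.ofReal (Real.Gamma (((n : ℝ) + ω) / 2 + 1 / 2)) *
            ENNReal.ofReal ((1 + ∑ j, x j ^ 2 + t ^ 2) ^ (-(((n + 1 : ℕ) : ℝ) + ω) / 2))) := by
      refine lintegral_congr fun t => ?_
      rw [← ENNReal.ofReal_mul hΓ'.le, ← ENNReal.ofReal_mul (by positivity), hΓexp]
      congr 1
      rw [add_comm (t ^ 2), ← add_assoc]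
      ring
    _ = _ := by
      rw [lintegral_const_mul _ (by fun_prop), lintegral_const_mul _ (by fun_prop), h,
        ← ENNReal.ofReal_mul (by positivity), ← hpi, add_comm ω]
      congr 1
      rw [← neg_div]
      ring

theorem Matrix.det_sq_of_mem_orthogonalGroup {n : Type*} [Fintype n] [DecidableEq n]
    {Q : Matrix n n ℝ} (hQ : Q ∈ Matrix.orthogonalGroup n ℝ) : Q.det ^ 2 = 1 := by
  have h := congrArg Matrix.det ((Matrix.mem_orthogonalGroup_iff n ℝ).1 hQ)
  rwa [Matrix.det_mul, Matrix.det_transpose, Matrix.det_one, ← sq] at h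

/-- The beta type II distribution is invariant under orthogonal transformations. -/
theorem measurePreserving_mulVec_betaIIRowMeasure {N : ℕ} (ω : ℝ) {Q : Matrix (Fin N) (Fin N) ℝ}
    (hQ : Q ∈ Matrix.orthogonalGroup (Fin N) ℝ) :
    MeasurePreserving Q.mulVec (betaIIRowMeasure N ω) (betaIIRowMeasure N ω) := by
  have hdet : |Q.det| = 1 :=
    (abs_eq zero_le_one).2 (sq_eq_one_iff.1 (Matrix.det_sq_of_mem_orthogonalGroup hQ))
  have hvol : MeasurePreserving Q.mulVec := by
    refine ⟨by fun_prop, ?_⟩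
    have h := Real.map_matrix_volume_pi_eq_smul_volume_pi (M := Q) (by
      intro h0
      simp [h0] at hdet)
    rwa [abs_inv, hdet, inv_one, ENNReal.ofReal_one, one_smul] at h
  have hnorm (x : Fin N → ℝ) : ∑ j, Q.mulVec x j ^ 2 = ∑ j, x j ^ 2 := by
    have h : Q.mulVec x ⬝ᵥ Q.mulVec x = x ⬝ᵥ x := by
      rw [Matrix.dotProduct_mulVec, Matrix.vecMul_mulVec,
        (Matrix.mem_orthogonalGroup_iff' (Fin N) ℝ).1 hQ, Matrix.vecMul_one]
    simpa [dotProduct, sq] using h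
  refine ⟨by fun_prop, Measure.ext_of_lintegral _ fun f hf => ?_⟩
  rw [lintegral_map hf (by fun_prop), lintegral_betaIIRowMeasure _ _ (by fun_prop),
    lintegral_betaIIRowMeasure _ _ hf]
  nth_rewrite 2 [← hvol.lintegral_comp (by fun_prop)]
  simp only [hnorm]

theorem exists_orthogonal_mulVec_eq {n : ℕ} (x : Fin (n + 1) → ℝ) :
    ∃ Q ∈ Matrix.orthogonalGroup (Fin (n + 1)) ℝ,
      Q.mulVec x = Pi.single 0 √(∑ j, x j ^ 2) := by
  by_cases hx : x = 0
  · subst hx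
    exact ⟨1, one_mem _, by simp⟩
  set v : EuclideanSpace ℝ (Fin (n + 1)) := WithLp.toLp 2 x with hv
  have hv0 : v ≠ 0 := by simpa [hv] using hx
  have hnorm : ‖v‖ = √(∑ j, x j ^ 2) := by simp [EuclideanSpace.norm_eq, hv]
  obtain ⟨b, hb⟩ := Orthonormal.exists_orthonormalBasis_extension_of_card_eq
    (𝕜 := ℝ) (ι := Fin (n + 1)) (by simp) (v := fun _ => ‖v‖⁻¹ • v) (s := {0}) (by
      refine ⟨fun i => ?_, fun i j hij => (hij (Subsingleton.elim i j)).elim⟩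
      simp [norm_smul, hv0])
  have hb0 : v = ‖v‖ • b 0 := by
    rw [hb 0 rfl, smul_smul, mul_inv_cancel₀ (norm_ne_zero_iff.2 hv0), one_smul]
  have horth (i j : Fin (n + 1)) : ∑ k, b i k * b j k = if i = j then 1 else 0 := by
    rw [← orthonormal_iff_ite.1 b.orthonormal i j]
    simp [PiLp.inner_apply, mul_comm]
  refine ⟨Matrix.of fun i j => b i j, ?_, ?_⟩
  · rw [Matrix.mem_orthogonalGroup_iff]
    ext i j
    simp [Matrix.mul_apply, Matrix.one_apply, horth]
  · have hxj (j : Fin (n + 1)) : x j = ‖v‖ * b 0 j := by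
      simpa [hv] using congrArg (fun w : EuclideanSpace ℝ (Fin (n + 1)) => w j) hb0
    ext i
    have hsum : ∑ j, b i j * x j = ‖v‖ * if i = 0 then 1 else 0 := by
      rw [← horth i 0, Finset.mul_sum]
      refine Finset.sum_congr rfl fun j _ => ?_
      rw [hxj j]
      ring
    simpa [Matrix.mulVec, dotProduct, Pi.single_apply, ← hnorm] using hsum

/-- If `Q` is orthogonal and rotates the first row onto the first axis, the squared determinant is
the squared norm of that row times the squared minor of the remaining rotated rows. -/
theorem det_cons_sq {n : ℕ} {Q : Matrix (Fin (n + 1)) (Fin (n + 1)) ℝ}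
    (hQ : Q ∈ Matrix.orthogonalGroup (Fin (n + 1)) ℝ) {x : Fin (n + 1) → ℝ}
    (hx : Q.mulVec x = Pi.single 0 √(∑ j, x j ^ 2)) (R : Fin n → Fin (n + 1) → ℝ) :
    Matrix.det (Matrix.of (Fin.cons x R : Fin (n + 1) → Fin (n + 1) → ℝ)) ^ 2 =
      (∑ j, x j ^ 2) * Matrix.det (Matrix.of fun i j => Q.mulVec (R i) (Fin.succ j)) ^ 2 := by
  set M : Matrix (Fin (n + 1)) (Fin (n + 1)) ℝ :=
    Matrix.of (Fin.cons x R : Fin (n + 1) → Fin (n + 1) → ℝ) with hM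
  have hmul (i j : Fin (n + 1)) : (M * Q.transpose) i j = Q.mulVec (M i) j := by
    simp [Matrix.mul_apply, Matrix.mulVec, dotProduct, mul_comm]
  have hdet : (M * Q.transpose).det = √(∑ j, x j ^ 2) *
      Matrix.det (Matrix.of fun i j => Q.mulVec (R i) (Fin.succ j)) := by
    have hrow (j : Fin (n + 1)) :
        (M * Q.transpose) 0 j = Pi.single (M := fun _ => ℝ) 0 √(∑ j, x j ^ 2) j := by
      rw [hmul, ← hx]
      rfl
    rw [Matrix.det_succ_row_zero, Finset.sum_eq_single 0]
    · rw [hrow]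
      simp only [Fin.val_zero, pow_zero, one_mul, Pi.single_eq_same]
      congr 2
      ext i j
      exact hmul _ _
    · intro j _ hj
      simp [hrow, hj]
    · simp
  rw [Matrix.det_mul, Matrix.det_transpose] at hdet
  calc
    M.det ^ 2 = (M.det * Q.det) ^ 2 := by
      rw [mul_pow, Matrix.det_sq_of_mem_orthogonalGroup hQ, mul_one]
    _ = _ := by rw [hdet, mul_pow, Real.sq_sqrt (by positivity)]

theorem lintegral_pi_succ {n : ℕ} {α : Type*} [MeasurableSpace α]
    (μ : Fin (n + 1) → Measure α) [∀ i, SigmaFinite (μ i)] {f : (Fin (n + 1) → α) → ℝ≥0∞}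
    (hf : Measurable f) :
    ∫⁻ x, f x ∂Measure.pi μ =
      ∫⁻ a, ∫⁻ y, f (Fin.cons a y : Fin (n + 1) → α) ∂Measure.pi (fun i => μ (Fin.succ i)) ∂μ 0 := by
  rw [← (measurePreserving_piFinSuccAbove μ 0).symm.lintegral_comp hf,
    lintegral_prod _ (by fun_prop)]
  simp only [MeasurableEquiv.piFinSuccAbove_symm_apply, Fin.insertNthEquiv_zero,
    Fin.zero_succAbove]
  rfl

theorem measurable_det_of (N : ℕ) :
    Measurable fun M : Fin N → Fin N → ℝ => Matrix.det (Matrix.of M) := by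
  simp only [Matrix.det_apply, Matrix.of_apply]
  fun_prop

theorem map_det_sq_pi_betaIIRowMeasure (N : ℕ) (ω : Fin N → ℝ) (hω : ∀ l, 0 < ω l) :
    Measure.map (fun M : Fin N → Fin N → ℝ => Matrix.det (Matrix.of M) ^ 2)
        (Measure.pi fun l => betaIIRowMeasure N (ω l)) =
      Measure.map (fun z : Fin N → ℝ => ∏ l, z l)
        (Measure.pi fun l : Fin N =>
          betaPrimeMeas (((N : ℝ) - (l : ℕ)) / 2) (ω l / 2)) := by
  induction N with
  | zero => simp
  | succ n ih =>
    have hmeas (k : ℕ) := measurable_det_of k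
    refine Measure.ext_of_lintegral _ fun f hf => ?_
    rw [lintegral_map hf ((hmeas _).pow_const 2), lintegral_map hf (by fun_prop),
      lintegral_pi_succ _ (f := fun M => f (Matrix.det (Matrix.of M) ^ 2))
        (hf.comp ((hmeas _).pow_const 2)), lintegral_pi_succ _ (by fun_prop)]
    have hprob : betaPrimeMeas ((((n + 1 : ℕ) : ℝ) - ((0 : Fin (n + 1)) : ℕ)) / 2) (ω 0 / 2) =
        (betaIIRowMeasure (n + 1) (ω 0)).map (fun x => ∑ j, x j ^ 2) := by
      rw [map_sum_sq_betaIIRowMeasure]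
      simp
    have hshift (i : Fin n) : (((n + 1 : ℕ) : ℝ) - (i.succ : ℕ)) / 2 = ((n : ℝ) - (i : ℕ)) / 2 := by
      push_cast [Fin.val_succ]
      ring
    simp only [hprob, hshift, Fin.prod_univ_succ, Fin.cons_zero, Fin.cons_succ]
    rw [lintegral_map (Measurable.lintegral_prod_right' (f := fun p : ℝ × (Fin n → ℝ) =>
      f (p.1 * ∏ i, p.2 i)) (by fun_prop)) (by fun_prop)]
    refine lintegral_congr fun x => ?_
    obtain ⟨Q, hQ, hx⟩ := exists_orthogonal_mulVec_eq x
    simp only [det_cons_sq hQ hx]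
    have hg : Measurable fun y : ℝ => f ((∑ j, x j ^ 2) * y) := by fun_prop
    have hrows := measurePreserving_pi _ _ fun i : Fin n =>
      (measurePreserving_tail_betaIIRowMeasure n (hω i.succ)).comp
        (measurePreserving_mulVec_betaIIRowMeasure (ω i.succ) hQ)
    calc
      _ = ∫⁻ R, f ((∑ j, x j ^ 2) * Matrix.det (Matrix.of R) ^ 2)
            ∂Measure.pi fun i : Fin n => betaIIRowMeasure n (ω i.succ) :=
        hrows.lintegral_comp (hg.comp ((hmeas n).pow_const 2))
      _ = ∫⁻ y, f ((∑ j, x j ^ 2) * y) ∂Measure.map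
            (fun M : Fin n → Fin n → ℝ => Matrix.det (Matrix.of M) ^ 2)
            (Measure.pi fun i : Fin n => betaIIRowMeasure n (ω i.succ)) :=
        (lintegral_map hg ((hmeas n).pow_const 2)).symm
      _ = _ := by
        rw [ih (fun i => ω i.succ) fun i => hω i.succ, lintegral_map hg (by fun_prop)]

theorem statement5 (N : ℕ) (hN : 0 < N) (ω : Fin N → ℝ) (hω : ∀ l, 0 < ω l) :
    Measure.map (fun M : Fin N → Fin N → ℝ => Matrix.det (Matrix.of M) ^ 2)
        (Measure.pi fun l => betaIIRowMeasure N (ω l)) =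
      Measure.map (fun z : Fin N → ℝ => ∏ l, z l)
        (Measure.pi fun l : Fin N =>
          betaPrimeMeas (((N : ℝ) - (l : ℕ)) / 2) (ω l / 2)) := by
  exact map_det_sq_pi_betaIIRowMeasure N ω hω
end

section
/- Let N be a positive integer and let σ_1, …, σ_N > 0. Let X be a random N×N real matrix whose rows are independent, with row l distributed according to the Gaussian density (2πσ_l²)^{-N/2} exp(−|x|²/(2σ_l²)) on ℝ^N. Then E[log|det X|] is finite and equals (1/2) Σ_{l=1}^N ( log(2σ_l²) + Ψ((N−l+1)/2) ), where Ψ(x) = (d/dx) log Γ(x) is the digamma function. -/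
open MeasureTheory Real

/-- The digamma function `Ψ(x) = (d/dx) log Γ(x)`. -/
noncomputable def digamma (x : ℝ) : ℝ := deriv (fun y => Real.log (Real.Gamma y)) x

/-- The distribution on `ℝ^N` of a row with isotropic Gaussian density
`(2πσ²)^{-N/2} exp(-|x|²/(2σ²))` with respect to Lebesgue measure. -/
noncomputable def gaussianRowMeasure (N : ℕ) (σ : ℝ) : Measure (Fin N → ℝ) :=
  volume.withDensity fun x =>
    ENNReal.ofReal ((2 * π * σ ^ 2) ^ (-(N : ℝ) / 2) *
      Real.exp (-(∑ j, x j ^ 2) / (2 * σ ^ 2)))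

open ProbabilityTheory Set Filter Asymptotics

/-- The coordinates of an isotropic Gaussian row are independent centred Gaussians. -/
theorem gaussianRowMeasure_eq_pi (N : ℕ) {σ : ℝ} (hσ : 0 < σ) :
    gaussianRowMeasure N σ =
      Measure.pi fun _ : Fin N => gaussianReal 0 (.mk (σ ^ 2) (sq_nonneg σ)) := by
  set v : NNReal := .mk (σ ^ 2) (sq_nonneg σ)
  have hvσ : (v : ℝ) = σ ^ 2 := rfl
  have hv0 : v ≠ 0 := by
    rw [← NNReal.coe_ne_zero, hvσ]; positivity
  have hdens : ∀ x : Fin N → ℝ,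
      (2 * π * σ ^ 2) ^ (-(N : ℝ) / 2) * Real.exp (-(∑ j, x j ^ 2) / (2 * σ ^ 2)) =
        ∏ j, gaussianPDFReal 0 v (x j) := by
    intro x
    simp only [gaussianPDFReal, hvσ, Finset.prod_mul_distrib, sub_zero, ← Real.exp_sum]
    congr 1
    · rw [Finset.prod_const, Finset.card_univ, Fintype.card_fin, Real.sqrt_eq_rpow,
        ← Real.rpow_neg (by positivity), ← Real.rpow_natCast _ N, ← Real.rpow_mul (by positivity)]
      congr 1; ring
    · rw [← Finset.sum_div, Finset.sum_neg_distrib]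
  have hint : Integrable fun x : Fin N → ℝ => ∏ j, gaussianPDFReal 0 v (x j) :=
    Integrable.fintype_prod fun _ => integrable_gaussianPDFReal 0 v
  refine (Measure.pi_eq fun s hs => ?_).symm
  rw [gaussianRowMeasure, withDensity_apply _ (MeasurableSet.univ_pi hs)]
  simp_rw [hdens]
  rw [← ofReal_integral_eq_lintegral_ofReal hint.integrableOn
    (ae_of_all _ fun x => Finset.prod_nonneg fun j _ => gaussianPDFReal_nonneg 0 v (x j)),
    volume_pi, Measure.restrict_pi_pi]
  erw [integral_fintype_prod_eq_prod (fun _ : Fin N => gaussianPDFReal 0 v)]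
  rw [ENNReal.ofReal_prod_of_nonneg fun i _ =>
    integral_nonneg fun x => gaussianPDFReal_nonneg 0 v x]
  exact Finset.prod_congr rfl fun i _ => (gaussianReal_apply_eq_integral 0 hv0 (s i)).symm

/-- The derivative in `s` of `∫ t ^ (s - 1) * exp (-t ^ 2 / 2)` is the integral with an extra
factor `log t`, expressed through the digamma function. -/
theorem integral_rpow_mul_log_mul_exp_neg_sq_div_two {s : ℝ} (hs : 0 < s) :
    IntegrableOn (fun t : ℝ => t ^ (s - 1) * (log t * exp (-t ^ 2 / 2))) (Ioi 0) ∧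
    ∫ t in Ioi (0:ℝ), t ^ (s - 1) * (log t * exp (-t ^ 2 / 2)) =
      (log 2 + digamma (s / 2)) / 2 * ∫ t in Ioi (0:ℝ), t ^ (s - 1) * exp (-t ^ 2 / 2) := by
  set f : ℝ → ℂ := fun t => (exp (-t ^ 2 / 2) : ℝ) with hf
  have hfc : Continuous f := by fun_prop
  obtain ⟨hconv, hder⟩ := mellin_hasDerivAt_of_isBigO_rpow (s := (s : ℂ)) (a := s + 1) (b := 0)
    (f := f) (hfc.locallyIntegrable.locallyIntegrableOn _) (by
      refine IsBigO.trans ?_ ((exp_neg_mul_sq_isLittleO_exp_neg one_half_pos).trans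
        (by simpa using isLittleO_exp_neg_mul_rpow_atTop one_pos (-(s + 1)))).isBigO
      refine IsBigO.of_bound 1 (Eventually.of_forall fun t => ?_)
      rw [hf, Complex.norm_real, one_mul, neg_div, neg_mul, one_div_mul_eq_div]) (by simp) (by
      simp only [neg_zero, rpow_zero]
      exact (hfc.tendsto 0).isBigO_one ℝ |>.mono nhdsWithin_le_nhds) (by simpa using hs)
  have hcpow : ∀ (r t : ℝ), t ∈ Ioi (0:ℝ) → (t : ℂ) ^ ((r : ℂ) - 1) = ((t ^ (r - 1) : ℝ) : ℂ) := by
    intro r t ht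
    rw [Complex.ofReal_cpow (le_of_lt ht)]; push_cast; rfl
  have hmel : ∀ r : ℝ, mellin f r =
      ((∫ t in Ioi (0:ℝ), t ^ (r - 1) * exp (-t ^ 2 / 2) : ℝ) : ℂ) := by
    intro r
    rw [mellin, ← integral_complex_ofReal]
    refine setIntegral_congr_fun measurableSet_Ioi fun t ht => ?_
    simp only [hcpow r t ht, hf, smul_eq_mul, Complex.ofReal_mul]
  have hlog : EqOn (fun t : ℝ => (t : ℂ) ^ ((s : ℂ) - 1) • (log t • f t))
      (fun t => ((t ^ (s - 1) * (log t * exp (-t ^ 2 / 2)) : ℝ) : ℂ)) (Ioi 0) := by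
    intro t ht
    simp only [hcpow s t ht, hf, smul_eq_mul, Complex.ofReal_mul, Complex.real_smul]
  have hint : IntegrableOn (fun t : ℝ => t ^ (s - 1) * (log t * exp (-t ^ 2 / 2))) (Ioi 0) := by
    have h := ((integrableOn_congr_fun hlog measurableSet_Ioi).1 hconv).re
    simpa only [IntegrableOn, RCLike.re_eq_complex_re, Complex.ofReal_re] using! h
  refine ⟨hint, ?_⟩
  have hval : mellin (fun t => log t • f t) s =
      ((∫ t in Ioi (0:ℝ), t ^ (s - 1) * (log t * exp (-t ^ 2 / 2)) : ℝ) : ℂ) := by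
    rw [mellin, ← integral_complex_ofReal]
    exact setIntegral_congr_fun measurableSet_Ioi hlog
  have hd := hder.real_of_complex
  rw [hval, Complex.ofReal_re] at hd
  simp only [hmel, Complex.ofReal_re] at hd
  have hG : ∀ r : ℝ, 0 < r → ∫ t in Ioi (0:ℝ), t ^ (r - 1) * exp (-t ^ 2 / 2) =
      (1 / 2) ^ (-(r / 2)) * (1 / 2) * Gamma (r / 2) := by
    intro r hr
    have := integral_rpow_mul_exp_neg_mul_rpow (p := 2) (q := r - 1) (b := 1 / 2) (by norm_num)
      (by linarith) (by norm_num)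
    rw [sub_add_cancel, neg_div] at this
    rw [← this]
    refine integral_congr_ae (ae_of_all _ fun t => ?_)
    simp only [rpow_two]
    congr 2; ring
  have hpos : 0 < Gamma (s / 2) := Gamma_pos_of_pos (by positivity)
  have hdG : HasDerivAt Gamma (deriv Gamma (s / 2)) (s / 2) :=
    (differentiableAt_Gamma fun m => by
      have : (0:ℝ) ≤ m := m.cast_nonneg
      have : 0 < s / 2 := by positivity
      linarith).hasDerivAt
  have hdig : digamma (s / 2) = deriv Gamma (s / 2) / Gamma (s / 2) := (hdG.log hpos.ne').deriv
  have hhalf : HasDerivAt (fun r : ℝ => r / 2) (1 / 2) s := (hasDerivAt_id s).div_const 2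
  have hd2 := ((hhalf.neg.const_rpow (a := 1 / 2) (by norm_num)).mul_const (1 / 2)).mul
    (HasDerivAt.comp s hdG hhalf)
  have hd3 := hd.congr_of_eventuallyEq
    (f₁ := fun r => (1 / 2 : ℝ) ^ (-(r / 2)) * (1 / 2) * Gamma (r / 2))
    (by filter_upwards [lt_mem_nhds hs] with r hr using (hG r hr).symm)
  rw [hd3.unique hd2, hG s hs, hdig]
  have : log (1 / 2) = - log 2 := by rw [one_div, log_inv]
  rw [this]
  simp
  field_simp

/-- The standard Gaussian distribution on `Fin N → ℝ`. -/
noncomputable abbrev stdRow (N : ℕ) : Measure (Fin N → ℝ) :=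
  Measure.pi fun _ => gaussianReal 0 1

/-- The distribution of an `N × N` matrix with independent standard Gaussian entries. -/
noncomputable abbrev stdGinibre (N : ℕ) : Measure (Fin N → Fin N → ℝ) :=
  Measure.pi fun _ => stdRow N

theorem stdRow_eq_withDensity (N : ℕ) :
    stdRow N = volume.withDensity fun x => ENNReal.ofReal
      ((2 * π) ^ (-(N : ℝ) / 2) * exp (-‖WithLp.toLp 2 x‖ ^ 2 / 2)) := by
  have h := gaussianRowMeasure_eq_pi N one_pos
  have h1 : NNReal.mk (1 ^ 2) (sq_nonneg 1) = 1 := by ext; simp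
  rw [h1] at h
  refine h.symm.trans ?_
  simp [gaussianRowMeasure, EuclideanSpace.real_norm_sq_eq]

theorem log_norm_stdRow {N : ℕ} (hN : 0 < N) :
    Integrable (fun x => log ‖WithLp.toLp 2 x‖) (stdRow N) ∧
    ∫ x, log ‖WithLp.toLp 2 x‖ ∂(stdRow N) = (log 2 + digamma ((N : ℝ) / 2)) / 2 := by
  have : Nonempty (Fin N) := ⟨⟨0, hN⟩⟩
  set c : ℝ := (2 * π) ^ (-(N : ℝ) / 2) with hc
  have hc0 : 0 < c := by positivity
  have hmeas : Measurable fun x : Fin N → ℝ => ENNReal.ofReal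
      (c * exp (-‖WithLp.toLp 2 x‖ ^ 2 / 2)) := by fun_prop
  have hdens : ∀ x : Fin N → ℝ, (ENNReal.ofReal
      (c * exp (-‖WithLp.toLp 2 x‖ ^ 2 / 2))).toReal = c * exp (-‖WithLp.toLp 2 x‖ ^ 2 / 2) :=
    fun x => ENNReal.toReal_ofReal (by positivity)
  have hemb := (MeasurableEquiv.toLp 2 (Fin N → ℝ)).measurableEmbedding
  have hvol := PiLp.volume_preserving_toLp (Fin N)
  have hrow : ∀ g : ℝ → ℝ, ∫ x, g ‖WithLp.toLp 2 x‖ ∂(stdRow N) =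
      c * (N * (volume.real (Metric.ball (0 : EuclideanSpace ℝ (Fin N)) 1) *
        ∫ t in Ioi (0:ℝ), t ^ ((N : ℝ) - 1) * (g t * exp (-t ^ 2 / 2)))) := by
    intro g
    rw [stdRow_eq_withDensity, integral_withDensity_eq_integral_toReal_smul hmeas
      (ae_of_all _ fun _ => ENNReal.ofReal_lt_top)]
    simp_rw [hdens, smul_eq_mul]
    have h1 := hvol.integral_comp hemb
      (fun y => c * exp (-‖y‖ ^ 2 / 2) * g ‖y‖)
    have h2 := integral_fun_norm_addHaar (volume : Measure (EuclideanSpace ℝ (Fin N)))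
      (fun t => g t * exp (-t ^ 2 / 2))
    rw [finrank_euclideanSpace_fin, nsmul_eq_mul, smul_eq_mul] at h2
    rw [h1]
    simp_rw [mul_assoc, integral_const_mul, mul_comm (exp _)]
    rw [h2]
    congr 3
    refine setIntegral_congr_fun measurableSet_Ioi fun t ht => ?_
    simp only [smul_eq_mul]
    rw [← rpow_natCast t (N - 1), Nat.cast_sub hN, Nat.cast_one]
  obtain ⟨hint, hval⟩ := integral_rpow_mul_log_mul_exp_neg_sq_div_two (s := N)
    (by exact_mod_cast hN)
  constructor
  · rw [stdRow_eq_withDensity, integrable_withDensity_iff_integrable_smul' hmeas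
      (ae_of_all _ fun _ => ENNReal.ofReal_lt_top)]
    simp_rw [hdens, smul_eq_mul]
    have h1 := hvol.integrable_comp_emb hemb
      (g := fun y => c * exp (-‖y‖ ^ 2 / 2) * log ‖y‖)
    refine h1.2 ?_
    simp_rw [mul_assoc, mul_comm (exp _)]
    refine Integrable.const_mul ?_ c
    refine (integrable_fun_norm_addHaar (volume : Measure (EuclideanSpace ℝ (Fin N)))
      (f := fun t => log t * exp (-t ^ 2 / 2))).2 ?_
    refine (integrableOn_congr_fun (fun t ht => ?_) measurableSet_Ioi).1 hint
    simp only [smul_eq_mul]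
    rw [finrank_euclideanSpace_fin, ← rpow_natCast t (N - 1), Nat.cast_sub hN, Nat.cast_one]
  · have h1 := hrow fun _ => 1
    simp only [integral_const, probReal_univ, smul_eq_mul, one_mul] at h1
    rw [hrow log, hval]
    linear_combination -(log 2 + digamma ((N : ℝ) / 2)) / 2 * h1

theorem measurePreserving_isometry_stdRow {N : ℕ}
    (φ : EuclideanSpace ℝ (Fin N) ≃ₗᵢ[ℝ] EuclideanSpace ℝ (Fin N)) :
    MeasurePreserving (fun x : Fin N → ℝ => (φ (WithLp.toLp 2 x)).ofLp) (stdRow N) (stdRow N) := by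
  have h1 : MeasurePreserving (MeasurableEquiv.toLp 2 (Fin N → ℝ)) (stdRow N)
      (stdGaussian (EuclideanSpace ℝ (Fin N))) :=
    ⟨MeasurableEquiv.measurable _, map_pi_eq_stdGaussian⟩
  have h2 : MeasurePreserving φ (stdGaussian (EuclideanSpace ℝ (Fin N)))
      (stdGaussian (EuclideanSpace ℝ (Fin N))) := ⟨φ.continuous.measurable, stdGaussian_map φ⟩
  exact (h1.symm _).comp (h2.comp h1)

theorem measurePreserving_tail_stdRow (N : ℕ) :
    MeasurePreserving (fun (x : Fin (N + 1) → ℝ) (j : Fin N) => x j.succ)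
      (stdRow (N + 1)) (stdRow N) :=
  measurePreserving_snd.comp
    (measurePreserving_piFinSuccAbove (fun _ : Fin (N + 1) => gaussianReal 0 1) 0)

theorem abs_det_isometry_rows {N : ℕ}
    (φ : EuclideanSpace ℝ (Fin N) ≃ₗᵢ[ℝ] EuclideanSpace ℝ (Fin N)) (M : Fin N → Fin N → ℝ) :
    |(Matrix.of fun i => (φ (WithLp.toLp 2 (M i))).ofLp).det| = |(Matrix.of M).det| := by
  have hgram : ∀ A : Matrix (Fin N) (Fin N) ℝ, A.det ^ 2 = (A * A.transpose).det := fun A => by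
    rw [Matrix.det_mul, Matrix.det_transpose, sq]
  rw [← sq_eq_sq_iff_abs_eq_abs, hgram, hgram]
  congr 1
  ext i j
  have h := φ.inner_map_map (WithLp.toLp 2 (M i)) (WithLp.toLp 2 (M j))
  rw [PiLp.inner_apply, PiLp.inner_apply] at h
  simpa [Matrix.mul_apply, mul_comm] using h

theorem abs_det_cons_isometry {N : ℕ} (z : Fin (N + 1) → ℝ) (R : Fin N → Fin (N + 1) → ℝ)
    (φ : EuclideanSpace ℝ (Fin (N + 1)) ≃ₗᵢ[ℝ] EuclideanSpace ℝ (Fin (N + 1)))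
    (hφ : φ (WithLp.toLp 2 z) = EuclideanSpace.single 0 ‖WithLp.toLp 2 z‖) :
    |(Matrix.of (Fin.cons z R : Fin (N + 1) → Fin (N + 1) → ℝ)).det| =
      ‖WithLp.toLp 2 z‖ *
        |(Matrix.of fun (i j : Fin N) => φ (WithLp.toLp 2 (R i)) j.succ).det| := by
  rw [← abs_det_isometry_rows φ, Matrix.det_succ_row_zero, Fin.sum_univ_succ]
  simp [hφ, abs_mul]
  exact Or.inl rfl

theorem measurable_abs_det (N : ℕ) :
    Measurable fun M : Fin N → Fin N → ℝ => |(Matrix.of M).det| :=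
  have h : Continuous fun M : Fin N → Fin N → ℝ => |(Matrix.of M).det| :=
    (Continuous.matrix_det continuous_id).abs
  h.measurable

theorem measurable_norm_mul_abs_det (N : ℕ) :
    Measurable fun p : (Fin (N + 1) → ℝ) × (Fin N → Fin N → ℝ) =>
      ‖WithLp.toLp 2 p.1‖ * |(Matrix.of p.2).det| :=
  (by fun_prop : Measurable fun p : (Fin (N + 1) → ℝ) × (Fin N → Fin N → ℝ) =>
    ‖WithLp.toLp 2 p.1‖).mul ((measurable_abs_det N).comp measurable_snd)

/-- Rotating the first row `z` onto the first axis: `|det|` of an `(N + 1) × (N + 1)` standard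
Gaussian matrix has the law of `‖z‖ * |det|` with an independent `N × N` standard Gaussian matrix. -/
theorem map_abs_det_stdGinibre_succ (N : ℕ) :
    (stdGinibre (N + 1)).map (fun M => |(Matrix.of M).det|) =
      ((stdRow (N + 1)).prod (stdGinibre N)).map
        (fun p => ‖WithLp.toLp 2 p.1‖ * |(Matrix.of p.2).det|) := by
  have hdet := measurable_abs_det (N + 1)
  have hprod := measurable_norm_mul_abs_det N
  have hsplit := (measurePreserving_piFinSuccAbove (fun _ : Fin (N + 1) => stdRow (N + 1)) 0).symm
  ext s hs
  rw [Measure.map_apply hdet hs, Measure.map_apply hprod hs,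
    ← hsplit.measure_preimage (hdet hs).nullMeasurableSet,
    Measure.prod_apply (hsplit.measurable (hdet hs)), Measure.prod_apply (hprod hs)]
  refine lintegral_congr fun z => ?_
  obtain ⟨φ, hφ⟩ : ∃ φ : EuclideanSpace ℝ (Fin (N + 1)) ≃ₗᵢ[ℝ] EuclideanSpace ℝ (Fin (N + 1)),
      φ (WithLp.toLp 2 z) = EuclideanSpace.single 0 ‖WithLp.toLp 2 z‖ :=
    ⟨_, Submodule.reflection_sub (by simp)⟩
  have hT : MeasurePreserving (fun (R : Fin N → Fin (N + 1) → ℝ) (i j : Fin N) =>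
      φ (WithLp.toLp 2 (R i)) j.succ) (Measure.pi fun _ => stdRow (N + 1)) (stdGinibre N) :=
    measurePreserving_pi _ _ fun _ =>
      (measurePreserving_tail_stdRow N).comp (measurePreserving_isometry_stdRow φ)
  rw [← hT.measure_preimage (measurable_prodMk_left (hprod hs)).nullMeasurableSet]
  congr 1
  ext R
  simp only [mem_preimage]
  rw [← abs_det_cons_isometry z R φ hφ, ← Fin.insertNth_zero']
  rfl

theorem stdGinibre_log_abs_det (N : ℕ) :
    (∀ᵐ M ∂(stdGinibre N), (Matrix.of M).det ≠ 0) ∧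
    Integrable (fun M => log |(Matrix.of M).det|) (stdGinibre N) ∧
    ∫ M, log |(Matrix.of M).det| ∂(stdGinibre N) =
      ∑ l : Fin N, (log 2 + digamma (((N : ℝ) - (l : ℕ)) / 2)) / 2 := by
  induction N with
  | zero => simp [stdGinibre]
  | succ N ih =>
    obtain ⟨hne, hint, hval⟩ := ih
    have hmap := map_abs_det_stdGinibre_succ N
    have hdet := (measurable_abs_det (N + 1)).aemeasurable (μ := stdGinibre (N + 1))
    have hprod := (measurable_norm_mul_abs_det N).aemeasurable
      (μ := (stdRow (N + 1)).prod (stdGinibre N))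
    have hz : ∀ᵐ z ∂(stdRow (N + 1)), ‖WithLp.toLp 2 z‖ ≠ 0 := by
      have : NullSingletonClass (gaussianReal 0 1) := nullSingletonClass_gaussianReal one_ne_zero
      have : NullSingletonClass (stdRow (N + 1)) := Measure.pi_nullSingletonClass 0
      filter_upwards [Measure.ae_ne (stdRow (N + 1)) 0] with z hz
      simpa using hz
    have hne₁ := Measure.quasiMeasurePreserving_fst (μ := stdRow (N + 1))
      (ν := stdGinibre N) |>.ae hz
    have hne₂ := Measure.quasiMeasurePreserving_snd (μ := stdRow (N + 1))
      (ν := stdGinibre N) |>.ae hne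
    obtain ⟨hrow, hrowval⟩ := log_norm_stdRow N.succ_pos
    have hlog : (fun p : (Fin (N + 1) → ℝ) × (Fin N → Fin N → ℝ) =>
        log ‖WithLp.toLp 2 p.1‖ + log |(Matrix.of p.2).det|)
        =ᵐ[(stdRow (N + 1)).prod (stdGinibre N)]
        fun p => log (‖WithLp.toLp 2 p.1‖ * |(Matrix.of p.2).det|) := by
      filter_upwards [hne₁, hne₂] with p h₁ h₂
      rw [log_mul h₁ (abs_ne_zero.2 h₂)]
    have hrow' := hrow.comp_fst (stdGinibre N)
    have hint' := hint.comp_snd (stdRow (N + 1))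
    refine ⟨?_, ?_, ?_⟩
    · have h : ∀ᵐ x ∂((stdGinibre (N + 1)).map fun M => |(Matrix.of M).det|), x ≠ 0 := by
        rw [hmap, ae_map_iff hprod (p := (· ≠ 0)) (measurableSet_singleton 0).compl]
        filter_upwards [hne₁, hne₂] with p h₁ h₂ using mul_ne_zero h₁ (abs_ne_zero.2 h₂)
      filter_upwards [ae_of_ae_map hdet h] with M hM using abs_ne_zero.1 hM
    · refine Integrable.comp_aemeasurable (g := log) ?_ hdet
      rw [hmap, integrable_map_measure measurable_log.aestronglyMeasurable hprod]
      exact (hrow'.add hint').congr hlog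
    · rw [← integral_map hdet measurable_log.aestronglyMeasurable, hmap,
        integral_map hprod measurable_log.aestronglyMeasurable, ← integral_congr_ae hlog,
        integral_add hrow' hint', integral_fun_fst (fun z => log ‖WithLp.toLp 2 z‖),
        integral_fun_snd (fun M : Fin N → Fin N → ℝ => log |(Matrix.of M).det|),
        hrowval, hval, Fin.sum_univ_succ]
      simp

theorem measurePreserving_scale_stdGinibre {N : ℕ} {σ : Fin N → ℝ} (hσ : ∀ l, 0 < σ l) :
    MeasurePreserving (fun (M : Fin N → Fin N → ℝ) i j => σ i * M i j) (stdGinibre N)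
      (Measure.pi fun l => gaussianRowMeasure N (σ l)) := by
  simp_rw [fun l => gaussianRowMeasure_eq_pi N (hσ l)]
  refine measurePreserving_pi _ _ (f := fun i (x : Fin N → ℝ) j => σ i * x j) fun i =>
    measurePreserving_pi _ _ (f := fun _ x => σ i * x) fun _ => ⟨measurable_const_mul _, ?_⟩
  rw [gaussianReal_map_const_mul, mul_zero, mul_one]

theorem statement9 (N : ℕ) (hN : 0 < N) (σ : Fin N → ℝ) (hσ : ∀ l, 0 < σ l) :
    Integrable (fun M : Fin N → Fin N → ℝ => Real.log |Matrix.det (Matrix.of M)|)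
      (Measure.pi fun l => gaussianRowMeasure N (σ l)) ∧
    ∫ M : Fin N → Fin N → ℝ, Real.log |Matrix.det (Matrix.of M)|
        ∂(Measure.pi fun l => gaussianRowMeasure N (σ l)) =
      (1 / 2) * ∑ l : Fin N,
        (Real.log (2 * σ l ^ 2) + digamma (((N : ℝ) - (l : ℕ)) / 2)) := by
  obtain ⟨hne, hint, hval⟩ := stdGinibre_log_abs_det N
  have hmp := measurePreserving_scale_stdGinibre hσ
  have hmeas := (measurable_log.comp (measurable_abs_det N)).aestronglyMeasurable
    (μ := Measure.pi fun l => gaussianRowMeasure N (σ l))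
  have hlog : (fun M => (∑ l, log (σ l)) + log |(Matrix.of M).det|) =ᵐ[stdGinibre N]
      fun M => log |(Matrix.of fun i j => σ i * M i j).det| := by
    filter_upwards [hne] with M hM
    have h := Matrix.det_mul_column σ (Matrix.of M)
    simp only [Matrix.of_apply] at h
    rw [h, log_abs, log_abs, log_mul (Finset.prod_ne_zero_iff.2 fun l _ => (hσ l).ne') hM,
      log_prod fun l _ => (hσ l).ne']
  constructor
  · refine (hmp.integrable_comp hmeas).1 ?_
    exact ((integrable_const _).add hint).congr hlog
  · rw [← hmp.map_eq, integral_map hmp.aemeasurable (by rw [hmp.map_eq]; exact hmeas),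
      ← integral_congr_ae hlog, integral_add (integrable_const _) hint, hval, integral_const,
      probReal_univ, one_smul, ← Finset.sum_add_distrib, Finset.mul_sum]
    refine Finset.sum_congr rfl fun l _ => ?_
    rw [log_mul two_ne_zero (pow_ne_zero 2 (hσ l).ne'), log_pow]
    push_cast
    ring
end
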